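/- arXiv:2605.00771 — 2 statements merged into one kernel-verified Lean document; each statement's English description precedes it below -/
import Mathlib

section
/- The dyadic logit dynamics converge to π from any initial state: for every pair of states s, s' ∈ {0,1} × {0,1}, the k-step transition probability (P^k)(s, s') tends to π(s') as k → ∞. -/
/-!
STATEMENT 4: The dyadic logit dynamics converge to π from any initial state:
for all states s, s', the k-step transition probability (P^k)(s, s') tends to
π(s') as k → ∞.  (Dyad-level content of Proposition 1.)
-/

/-!
STATEMENT 1: The dyadic logit dynamics satisfy detailed balance with respect to π:
for all states s, s' ∈ {0,1} × {0,1}, π(s) · P(s, s') = π(s') · P(s', s).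
-/

noncomputable section
open Real

/-- Numerical value of a binary coordinate. -/
def ind (b : Bool) : ℝ := if b then 1 else 0

/-- Logistic function σ(x) = exp x / (1 + exp x). -/
def sigm (x : ℝ) : ℝ := exp x / (1 + exp x)

/-- Transition matrix of the dyadic logit dynamics on {0,1} × {0,1}: with probability `q`
the first coordinate is refreshed (to 1 with probability σ(B + b·C)), with probability
`1 − q` the second coordinate is refreshed (to 1 with probability σ(B' + a·C));
contributions of the two refresh moves to the same target state add. -/
def Pmat (B B' C q : ℝ) : Matrix (Bool × Bool) (Bool × Bool) ℝ := fun s s' =>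
  q * (if s'.2 = s.2 then
        (if s'.1 then sigm (B + ind s.2 * C) else 1 - sigm (B + ind s.2 * C)) else 0)
  + (1 - q) * (if s'.1 = s.1 then
        (if s'.2 then sigm (B' + ind s.1 * C) else 1 - sigm (B' + ind s.1 * C)) else 0)

/-- Stationary dyadic distribution
π(a,b) = exp(a·B + b·B' + a·b·C) / (1 + exp B + exp B' + exp(B + B' + C)). -/
def piDist (B B' C : ℝ) (s : Bool × Bool) : ℝ :=
  exp (ind s.1 * B + ind s.2 * B' + ind s.1 * ind s.2 * C)
    / (1 + exp B + exp B' + exp (B + B' + C))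


open Matrix in
/-- A row-stochastic matrix with entrywise positive `m`-th power has powers converging to its
stationary distribution. -/
theorem tendsto_pow_of_rowStochastic {n : Type*} [Fintype n] [DecidableEq n]
    {P : Matrix n n ℝ} (hP : P ∈ rowStochastic ℝ n) {m : ℕ} (hm : 0 < m)
    (hpos : ∀ i j, 0 < (P ^ m) i j) {μ : n → ℝ} (hμ0 : ∀ j, 0 ≤ μ j)
    (hμ1 : ∑ j, μ j = 1) (hμP : μ ᵥ* P = μ) (i j : n) :
    Filter.Tendsto (fun k : ℕ => (P ^ k) i j) Filter.atTop (nhds (μ j)) := by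
  let _ : NormedRing (Matrix n n ℝ) := Matrix.linftyOpNormedRing
  have : Nonempty n := ⟨i⟩
  set S : Matrix n n ℝ := Matrix.of fun _ j => μ j with hS
  have hSP : S * P = S := by
    ext a b
    exact congrFun hμP b
  have hSpow (k : ℕ) : S * P ^ k = S := by
    induction k with
    | zero => simp
    | succ k ih => rw [pow_succ, ← mul_assoc, ih, hSP]
  have hstoch (k : ℕ) : P ^ k ∈ rowStochastic ℝ n := pow_mem hP k
  have hpowS (k : ℕ) : P ^ k * S = S := by
    ext a b
    simp [Matrix.mul_apply, hS, ← Finset.sum_mul, sum_row_of_mem_rowStochastic (hstoch k) a]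
  have hSS : S * S = S := by
    ext a b
    simp [Matrix.mul_apply, hS, ← Finset.sum_mul, hμ1]
  obtain ⟨δ, hδ, hle⟩ : ∃ δ : ℝ, 0 < δ ∧ ∀ a b, δ ≤ (P ^ m) a b := by
    obtain ⟨p, hp⟩ := Finite.exists_min fun p : n × n => (P ^ m) p.1 p.2
    exact ⟨_, hpos p.1 p.2, fun a b => hp (a, b)⟩
  set R : Matrix n n ℝ := P ^ m - δ • S with hR
  have hR0 (a b : n) : 0 ≤ R a b := by
    have h1 : μ b ≤ 1 := hμ1 ▸ Finset.single_le_sum (fun c _ => hμ0 c) (Finset.mem_univ b)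
    have h2 := hle a b
    simp only [hR, hS, Matrix.sub_apply, Matrix.smul_apply, Matrix.of_apply, smul_eq_mul]
    nlinarith
  have hRsum (a : n) : ∑ b, R a b = 1 - δ := by
    simp [hR, hS, Finset.sum_sub_distrib, ← Finset.mul_sum, hμ1,
      sum_row_of_mem_rowStochastic (hstoch m) a]
  have hδ1 : 0 ≤ 1 - δ := hRsum i ▸ Finset.sum_nonneg fun b _ => hR0 i b
  have hnorm : ‖R‖ ≤ 1 - δ := by
    rw [Matrix.linfty_opNorm_def, ← NNReal.coe_mk _ hδ1, NNReal.coe_le_coe]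
    refine Finset.sup_le fun a _ => ?_
    rw [← NNReal.coe_le_coe]
    simp [abs_of_nonneg (hR0 a _), hRsum a]
  have hdecomp (r t : ℕ) : P ^ (m * t + r) - S = R ^ t * (P ^ r - S) := by
    induction t with
    | zero => simp
    | succ t ih =>
      rw [pow_succ', mul_assoc, ← ih, hR, sub_mul, mul_sub, hpowS, smul_mul_assoc, mul_sub,
        hSpow, hSS, sub_self, smul_zero, sub_zero, ← pow_add]
      congr 2
      ring
  set M : ℝ := ∑ r ∈ Finset.range m, ‖P ^ r - S‖
  have hbound (k : ℕ) : |(P ^ k) i j - μ j| ≤ (1 - δ) ^ (k / m) * M := by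
    have hentry : |(P ^ k) i j - μ j| ≤ ‖P ^ k - S‖ := by
      have h1 := Finset.le_sup (f := fun a => ∑ b, ‖(P ^ k - S) a b‖₊) (Finset.mem_univ i)
      have h2 := Finset.single_le_sum (f := fun b => ‖(P ^ k - S) i b‖₊)
        (fun _ _ => zero_le) (Finset.mem_univ j)
      rw [Matrix.linfty_opNorm_def]
      exact NNReal.coe_le_coe.2 (h2.trans h1)
    refine hentry.trans ?_
    nth_rewrite 1 [← Nat.div_add_mod k m]
    rw [hdecomp]
    have hR' : ‖R ^ (k / m) * (P ^ (k % m) - S)‖ ≤ ‖R‖ ^ (k / m) * ‖P ^ (k % m) - S‖ := by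
      generalize k / m = t
      generalize P ^ (k % m) - S = A
      induction t with
      | zero => simp
      | succ t ih =>
        rw [pow_succ', pow_succ', mul_assoc, mul_assoc]
        exact (norm_mul_le _ _).trans (by gcongr)
    refine hR'.trans ?_
    gcongr
    exact Finset.single_le_sum (f := fun r => ‖P ^ r - S‖) (fun _ _ => norm_nonneg _)
      (Finset.mem_range.2 (Nat.mod_lt k hm))
  have hlim : Filter.Tendsto (fun k : ℕ => (1 - δ) ^ (k / m) * M) Filter.atTop (nhds 0) := by
    rw [← zero_mul M]
    exact ((tendsto_pow_atTop_nhds_zero_of_lt_one hδ1 (by linarith)).comp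
      (Nat.tendsto_div_const_atTop hm.ne')).mul_const M
  exact tendsto_iff_norm_sub_tendsto_zero.2
    (squeeze_zero (fun _ => norm_nonneg _) hbound hlim)

theorem sigm_pos (x : ℝ) : 0 < sigm x := by
  unfold sigm
  positivity

theorem one_sub_sigm (x : ℝ) : 1 - sigm x = 1 / (1 + exp x) := by
  unfold sigm
  field_simp
  ring

theorem sigm_lt_one (x : ℝ) : sigm x < 1 := by
  rw [← sub_pos, one_sub_sigm]
  positivity

theorem ite_sigm_pos (x : ℝ) (c : Bool) : 0 < if c then sigm x else 1 - sigm x := by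
  split_ifs
  exacts [sigm_pos x, sub_pos.2 (sigm_lt_one x)]

theorem ite_ite_sigm_nonneg (x : ℝ) (c : Bool) (p : Prop) [Decidable p] :
    0 ≤ if p then (if c then sigm x else 1 - sigm x) else 0 := by
  by_cases hp : p
  · simpa only [if_pos hp] using (ite_sigm_pos x c).le
  · simp only [if_neg hp, le_refl]

theorem Pmat_nonneg (B B' C : ℝ) {q : ℝ} (hq0 : 0 < q) (hq1 : q < 1) (s s' : Bool × Bool) :
    0 ≤ Pmat B B' C q s s' :=
  add_nonneg (mul_nonneg hq0.le (ite_ite_sigm_nonneg _ _ _))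
    (mul_nonneg (sub_pos.2 hq1).le (ite_ite_sigm_nonneg _ _ _))

theorem Pmat_mem_rowStochastic (B B' C : ℝ) {q : ℝ} (hq0 : 0 < q) (hq1 : q < 1) :
    Pmat B B' C q ∈ Matrix.rowStochastic ℝ (Bool × Bool) := by
  refine Matrix.mem_rowStochastic_iff_sum.2 ⟨Pmat_nonneg B B' C hq0 hq1, ?_⟩
  rintro ⟨a, b⟩
  cases a <;> cases b <;> simp [Pmat, Fintype.sum_prod_type] <;> ring

/-- Every state is reached in two steps by refreshing first one coordinate, then the other. -/
theorem Pmat_sq_pos (B B' C : ℝ) {q : ℝ} (hq0 : 0 < q) (hq1 : q < 1) (s s' : Bool × Bool) :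
    0 < (Pmat B B' C q ^ 2) s s' := by
  have hq : 0 < 1 - q := sub_pos.2 hq1
  have h1 : 0 < Pmat B B' C q s (s'.1, s.2) := by
    refine add_pos_of_pos_of_nonneg (mul_pos hq0 ?_) (mul_nonneg hq.le (ite_ite_sigm_nonneg _ _ _))
    simpa only [if_true] using ite_sigm_pos _ _
  have h2 : 0 < Pmat B B' C q (s'.1, s.2) s' := by
    refine add_pos_of_nonneg_of_pos (mul_nonneg hq0.le (ite_ite_sigm_nonneg _ _ _)) (mul_pos hq ?_)
    simpa only [if_true] using ite_sigm_pos _ _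
  rw [pow_two, Matrix.mul_apply]
  exact Finset.sum_pos' (fun c _ => mul_nonneg (Pmat_nonneg B B' C hq0 hq1 _ _)
    (Pmat_nonneg B B' C hq0 hq1 _ _)) ⟨(s'.1, s.2), Finset.mem_univ _, mul_pos h1 h2⟩

theorem piDist_nonneg (B B' C : ℝ) (s : Bool × Bool) : 0 ≤ piDist B B' C s := by
  unfold piDist
  positivity

theorem sum_piDist (B B' C : ℝ) : ∑ s, piDist B B' C s = 1 := by
  simp only [piDist, Fintype.sum_prod_type, Fintype.sum_bool, ind]
  simp only [if_true, Bool.false_eq_true, if_false, one_mul, zero_mul, mul_zero, add_zero, zero_add,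
    exp_zero]
  field_simp
  ring

open Matrix in
theorem piDist_vecMul_Pmat (B B' C q : ℝ) :
    piDist B B' C ᵥ* Pmat B B' C q = piDist B B' C := by
  ext ⟨a, b⟩
  cases a <;> cases b <;>
    simp [Matrix.vecMul, dotProduct, Fintype.sum_prod_type, Pmat, piDist, ind, one_sub_sigm] <;>
    simp only [sigm, exp_add] <;> field_simp <;> ring

theorem convergence_to_stationary (B B' C q : ℝ) (hq0 : 0 < q) (hq1 : q < 1)
    (s s' : Bool × Bool) :
    Filter.Tendsto (fun k : ℕ => (Pmat B B' C q ^ k) s s')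
      Filter.atTop (nhds (piDist B B' C s')) := by
  exact tendsto_pow_of_rowStochastic (Pmat_mem_rowStochastic B B' C hq0 hq1) two_pos
    (Pmat_sq_pos B B' C hq0 hq1) (piDist_nonneg B B' C) (sum_piDist B B' C)
    (piDist_vecMul_Pmat B B' C q) s s'
end
end

section
/- Score formulas for the fixed effects: in the reciprocal dyadic network model, the log-likelihood ℓ, viewed as a function of the fixed effects, is differentiable, and for each node i its partial derivative with respect to α i equals d_i − Σ_{j≠i} p i j, and its partial derivative with respect to γ i equals b_i − Σ_{j≠i} p j i, where d_i = Σ_{j≠i} g i j and b_i = Σ_{j≠i} g j i. -/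
/-!
STATEMENT 11: Score formulas for the fixed effects: ℓ, viewed as a function of the
fixed effects, is differentiable; its partial derivative with respect to α i equals
d_i − Σ_{j≠i} p i j, and with respect to γ i equals b_i − Σ_{j≠i} p j i.
-/

noncomputable section
open Real Finset

/-- Euclidean inner product on `Fin d → ℝ`. -/
def dotp {d : ℕ} (v w : Fin d → ℝ) : ℝ := ∑ k, v k * w k

/-- `B i j = ⟨X i j, β⟩ + α i + γ j`. -/
def Bmat {n dx : ℕ} (X : Fin n → Fin n → Fin dx → ℝ) (β : Fin dx → ℝ)
    (α γ : Fin n → ℝ) (i j : Fin n) : ℝ := dotp (X i j) β + α i + γ j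

/-- `C i j = ⟨Z i j, ρ⟩`. -/
def Cmat {n dz : ℕ} (Z : Fin n → Fin n → Fin dz → ℝ) (ρ : Fin dz → ℝ)
    (i j : Fin n) : ℝ := dotp (Z i j) ρ

/-- `Denom i j = 1 + exp(B i j) + exp(B j i) + exp(B i j + B j i + C i j)`. -/
def DenomM {n dx dz : ℕ} (X : Fin n → Fin n → Fin dx → ℝ)
    (Z : Fin n → Fin n → Fin dz → ℝ) (β : Fin dx → ℝ) (ρ : Fin dz → ℝ)
    (α γ : Fin n → ℝ) (i j : Fin n) : ℝ :=
  1 + exp (Bmat X β α γ i j) + exp (Bmat X β α γ j i)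
    + exp (Bmat X β α γ i j + Bmat X β α γ j i + Cmat Z ρ i j)

/-- Dyadic probability `π i j (a, b) = exp(a·B i j + b·B j i + a·b·C i j) / Denom i j`. -/
def piDyad {n dx dz : ℕ} (X : Fin n → Fin n → Fin dx → ℝ)
    (Z : Fin n → Fin n → Fin dz → ℝ) (β : Fin dx → ℝ) (ρ : Fin dz → ℝ)
    (α γ : Fin n → ℝ) (i j : Fin n) (a b : ℝ) : ℝ :=
  exp (a * Bmat X β α γ i j + b * Bmat X β α γ j i + a * b * Cmat Z ρ i j)
    / DenomM X Z β ρ α γ i j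

/-- Marginal link probability `p i j = π i j (1,0) + π i j (1,1)`. -/
def pmarg {n dx dz : ℕ} (X : Fin n → Fin n → Fin dx → ℝ)
    (Z : Fin n → Fin n → Fin dz → ℝ) (β : Fin dx → ℝ) (ρ : Fin dz → ℝ)
    (α γ : Fin n → ℝ) (i j : Fin n) : ℝ :=
  piDyad X Z β ρ α γ i j 1 0 + piDyad X Z β ρ α γ i j 1 1

/-- `p11 i j = π i j (1,1)`. -/
def p11M {n dx dz : ℕ} (X : Fin n → Fin n → Fin dx → ℝ)
    (Z : Fin n → Fin n → Fin dz → ℝ) (β : Fin dx → ℝ) (ρ : Fin dz → ℝ)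
    (α γ : Fin n → ℝ) (i j : Fin n) : ℝ :=
  piDyad X Z β ρ α γ i j 1 1

/-- Log-likelihood `ℓ = Σ_{i<j} ln(π i j (g i j, g j i))`. -/
def loglik {n dx dz : ℕ} (g : Fin n → Fin n → ℝ) (X : Fin n → Fin n → Fin dx → ℝ)
    (Z : Fin n → Fin n → Fin dz → ℝ) (β : Fin dx → ℝ) (ρ : Fin dz → ℝ)
    (α γ : Fin n → ℝ) : ℝ :=
  ∑ i, ∑ j ∈ univ.filter (fun j => i < j),
    log (piDyad X Z β ρ α γ i j (g i j) (g j i))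

theorem Cmat_symm {n dz : ℕ} {Z : Fin n → Fin n → Fin dz → ℝ} (hZ : ∀ i j, Z i j = Z j i)
    (ρ : Fin dz → ℝ) (i j : Fin n) : Cmat Z ρ i j = Cmat Z ρ j i := by
  simp only [Cmat, hZ i j]

section Dyad

variable {n dx dz : ℕ} (X : Fin n → Fin n → Fin dx → ℝ) (Z : Fin n → Fin n → Fin dz → ℝ)
  (β : Fin dx → ℝ) (ρ : Fin dz → ℝ)

theorem DenomM_pos (α γ : Fin n → ℝ) (i j : Fin n) : 0 < DenomM X Z β ρ α γ i j := by
  unfold DenomM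
  positivity

theorem log_piDyad (α γ : Fin n → ℝ) (i j : Fin n) (a b : ℝ) :
    log (piDyad X Z β ρ α γ i j a b)
      = a * Bmat X β α γ i j + b * Bmat X β α γ j i + a * b * Cmat Z ρ i j
        - log (DenomM X Z β ρ α γ i j) := by
  rw [piDyad, log_div (exp_ne_zero _) (DenomM_pos X Z β ρ α γ i j).ne', log_exp]

theorem pmarg_eq (α γ : Fin n → ℝ) (i j : Fin n) :
    pmarg X Z β ρ α γ i j = (exp (Bmat X β α γ i j)
      + exp (Bmat X β α γ i j + Bmat X β α γ j i + Cmat Z ρ i j))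
        / DenomM X Z β ρ α γ i j := by
  simp [pmarg, piDyad, add_div]

theorem DenomM_symm {Z : Fin n → Fin n → Fin dz → ℝ} (hZ : ∀ i j, Z i j = Z j i)
    (α γ : Fin n → ℝ) (i j : Fin n) :
    DenomM X Z β ρ α γ j i = DenomM X Z β ρ α γ i j := by
  simp only [DenomM, Cmat_symm hZ ρ j i, add_comm (Bmat X β α γ j i) (Bmat X β α γ i j)]
  ring

/-- The score of a single dyad along a curve of fixed effects. -/
theorem hasDerivAt_log_piDyad {Z : Fin n → Fin n → Fin dz → ℝ} (hZ : ∀ i j, Z i j = Z j i)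
    {A G : ℝ → Fin n → ℝ} {A' G' : Fin n → ℝ} {t : ℝ}
    (hA : HasDerivAt A A' t) (hG : HasDerivAt G G' t) (i j : Fin n) (a b : ℝ) :
    HasDerivAt (fun s => log (piDyad X Z β ρ (A s) (G s) i j a b))
      ((a - pmarg X Z β ρ (A t) (G t) i j) * (A' i + G' j)
        + (b - pmarg X Z β ρ (A t) (G t) j i) * (A' j + G' i)) t := by
  have hB (k l : Fin n) :
      HasDerivAt (fun s => Bmat X β (A s) (G s) k l) (A' k + G' l) t :=
    ((hasDerivAt_pi.1 hA k).const_add _).add (hasDerivAt_pi.1 hG l)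
  have hD : HasDerivAt (fun s => DenomM X Z β ρ (A s) (G s) i j) _ t :=
    (((hB i j).exp.const_add 1).add (hB j i).exp).add
      (((hB i j).add (hB j i)).add_const (Cmat Z ρ i j)).exp
  have hpos := DenomM_pos X Z β ρ (A t) (G t) i j
  simp only [log_piDyad]
  refine (((((hB i j).const_mul a).add ((hB j i).const_mul b)).add_const
    (a * b * Cmat Z ρ i j)).sub (hD.log hpos.ne')).congr_deriv ?_
  rw [pmarg_eq, pmarg_eq, DenomM_symm X β ρ hZ, Cmat_symm hZ ρ j i,
    add_comm (Bmat X β (A t) (G t) j i) (Bmat X β (A t) (G t) i j)]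
  simp only [Pi.add_apply]
  field_simp
  ring

end Dyad

theorem sum_lt_add_swap {n : ℕ} (f : Fin n → Fin n → ℝ) :
    ∑ i, ∑ j ∈ univ.filter (fun j => i < j), (f i j + f j i)
      = ∑ i, ∑ j ∈ univ \ {i}, f i j := by
  have hswap : ∑ i, ∑ j ∈ univ.filter (fun j => i < j), f j i
      = ∑ i, ∑ j ∈ univ.filter (fun j => j < i), f i j := by
    simp only [sum_filter]
    exact sum_comm
  simp only [sum_add_distrib]
  rw [hswap, ← sum_add_distrib]
  refine sum_congr rfl fun i _ => ?_
  rw [← sum_union (disjoint_filter.2 fun j _ h => h.not_gt), ← filter_or]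
  congr 1
  ext j
  simp [eq_comm]

/-- The score of the log-likelihood along a curve of fixed effects. -/
theorem hasDerivAt_loglik {n dx dz : ℕ} (g : Fin n → Fin n → ℝ)
    (X : Fin n → Fin n → Fin dx → ℝ) {Z : Fin n → Fin n → Fin dz → ℝ}
    (hZ : ∀ i j, Z i j = Z j i) (β : Fin dx → ℝ) (ρ : Fin dz → ℝ)
    {A G : ℝ → Fin n → ℝ} {A' G' : Fin n → ℝ} {t : ℝ}
    (hA : HasDerivAt A A' t) (hG : HasDerivAt G G' t) :
    HasDerivAt (fun s => loglik g X Z β ρ (A s) (G s))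
      (∑ i, ∑ j ∈ univ \ {i},
        (g i j - pmarg X Z β ρ (A t) (G t) i j) * (A' i + G' j)) t := by
  rw [← sum_lt_add_swap]
  exact HasDerivAt.fun_sum fun i _ => HasDerivAt.fun_sum fun j _ =>
    hasDerivAt_log_piDyad X β ρ hZ hA hG i j (g i j) (g j i)

theorem differentiable_loglik {n dx dz : ℕ} (g : Fin n → Fin n → ℝ)
    (X : Fin n → Fin n → Fin dx → ℝ) (Z : Fin n → Fin n → Fin dz → ℝ)
    (β : Fin dx → ℝ) (ρ : Fin dz → ℝ) :
    Differentiable ℝ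
      (fun fe : (Fin n → ℝ) × (Fin n → ℝ) => loglik g X Z β ρ fe.1 fe.2) := by
  have hB (k l : Fin n) :
      Differentiable ℝ (fun fe : (Fin n → ℝ) × (Fin n → ℝ) => Bmat X β fe.1 fe.2 k l) := by
    unfold Bmat
    fun_prop
  have hD (i j : Fin n) : Differentiable ℝ
      (fun fe : (Fin n → ℝ) × (Fin n → ℝ) => log (DenomM X Z β ρ fe.1 fe.2 i j)) := by
    refine Differentiable.log ?_ fun fe => (DenomM_pos X Z β ρ fe.1 fe.2 i j).ne'
    unfold DenomM
    fun_prop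
  simp only [loglik, log_piDyad]
  fun_prop

theorem fixed_effects_score_formulas {n dx dz : ℕ} (hn : 2 ≤ n) (hdx : 1 ≤ dx)
    (hdz : 1 ≤ dz)
    (g : Fin n → Fin n → ℝ) (X : Fin n → Fin n → Fin dx → ℝ)
    (Z : Fin n → Fin n → Fin dz → ℝ)
    (hgdiag : ∀ i, g i i = 0) (hg01 : ∀ i j, g i j = 0 ∨ g i j = 1)
    (hZsymm : ∀ i j, Z i j = Z j i)
    (β : Fin dx → ℝ) (ρ : Fin dz → ℝ) (α γ : Fin n → ℝ) :
    Differentiable ℝ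
      (fun fe : (Fin n → ℝ) × (Fin n → ℝ) => loglik g X Z β ρ fe.1 fe.2) ∧
    (∀ i : Fin n,
      HasDerivAt (fun t => loglik g X Z β ρ (Function.update α i t) γ)
        ((∑ j ∈ univ \ {i}, g i j) - ∑ j ∈ univ \ {i}, pmarg X Z β ρ α γ i j)
        (α i)) ∧
    (∀ i : Fin n,
      HasDerivAt (fun t => loglik g X Z β ρ α (Function.update γ i t))
        ((∑ j ∈ univ \ {i}, g j i) - ∑ j ∈ univ \ {i}, pmarg X Z β ρ α γ j i)
        (γ i)) := by
  refine ⟨differentiable_loglik g X Z β ρ, fun i => ?_, fun i => ?_⟩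
  · refine (hasDerivAt_loglik g X hZsymm β ρ (hasDerivAt_update α i (α i))
      (hasDerivAt_const (α i) γ)).congr_deriv ?_
    rw [sum_eq_single i (fun k _ hk => by simp [hk]) (by simp)]
    simp
  · refine (hasDerivAt_loglik g X hZsymm β ρ (hasDerivAt_const (γ i) α)
      (hasDerivAt_update γ i (γ i))).congr_deriv ?_
    rw [sum_comm' (t' := univ) (s' := fun j => univ \ {j}) (by simp [eq_comm]),
      sum_eq_single i (fun k _ hk => by simp [hk]) (by simp)]
    simp
end
end
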